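/- arXiv:1005.3257 — 3 statements merged into one kernel-verified Lean document; each statement's English description precedes it below -/
import Mathlib

section
/- (Theorem 6.4, Bernstein's theorem, in integer-specialized form.) Let f ∈ R be nonzero. Then there exist a nonzero polynomial b ∈ K[X] and a finitely supported function c : (Fin n →₀ ℕ) →₀ R[Y] (encoding the operator P(s) = Σ_β c(β)(x,s)·∂^β ∈ D_n[s]) such that for every natural number m, Σ_β c(β)(m) · ∂^β(f^{m+1}) = b(m) · f^m holds in R, where b(m) ∈ K is the evaluation of b at m. (This is the specialization at every nonnegative integer value s = m of the Bernstein functional equation P(s)·f^{s+1} = b(s)·f^s.) -/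
open MvPolynomial

variable {K : Type*} [Field K] [CharZero K] {n : ℕ}

/-- The partial-derivative endomorphism with respect to `x_i`. -/
noncomputable def pd (i : Fin n) : Module.End K (MvPolynomial (Fin n) K) :=
  (pderiv i).toLinearMap

/-- The higher-derivative operator `∂^β = ∏_i (pderiv i)^{β(i)}` (the factors commute,
so the order of composition is irrelevant). -/
noncomputable def dpow (β : Fin n →₀ ℕ) : Module.End K (MvPolynomial (Fin n) K) :=
  (List.ofFn fun i : Fin n => (pd i) ^ (β i)).prod

section WeylAction

variable {F M : Type*} [Field F] [AddCommGroup M] [Module F M]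

/-- The families `X` and `D` of endomorphisms satisfy the defining relations of the Weyl algebra. -/
structure WeylAction (X D : Fin n → Module.End F M) : Prop where
  comm_X : ∀ i j, X i * X j = X j * X i
  comm_D : ∀ i j, D i * D j = D j * D i
  D_mul_X : ∀ i j, D i * X j = X j * D i + if i = j then 1 else 0

open scoped IsMulCommutative in
/-- Evaluation of multivariate polynomials at a commuting family in a noncommutative algebra. -/
noncomputable def commEval {A : Type*} [Ring A] [Algebra F A] (T : Fin n → A)
    (hT : ∀ i j, T i * T j = T j * T i) : MvPolynomial (Fin n) F →ₐ[F] A :=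
  haveI := Algebra.isMulCommutative_adjoin F (s := Set.range T) (by
    rintro _ ⟨i, rfl⟩ _ ⟨j, rfl⟩; exact hT i j)
  (Algebra.adjoin F (Set.range T)).val.comp
    (aeval fun i => (⟨T i, Algebra.subset_adjoin ⟨i, rfl⟩⟩ : Algebra.adjoin F (Set.range T)))

open scoped IsMulCommutative in
@[simp]
theorem commEval_X {A : Type*} [Ring A] [Algebra F A] (T : Fin n → A)
    (hT : ∀ i j, T i * T j = T j * T i) (i : Fin n) :
    commEval (F := F) T hT (MvPolynomial.X i) = T i := by
  simp [commEval]

theorem mul_commEval {A : Type*} [Ring A] [Algebra F A] (T : Fin n → A)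
    (hT : ∀ i j, T i * T j = T j * T i) (S : A) (i : Fin n)
    (hS : ∀ j, S * T j = T j * S + if i = j then 1 else 0) (p : MvPolynomial (Fin n) F) :
    S * commEval T hT p = commEval T hT p * S + commEval T hT (pderiv i p) := by
  induction p using MvPolynomial.induction_on with
  | C a =>
    rw [← MvPolynomial.algebraMap_eq, AlgHom.commutes, Algebra.commutes]
    simp [MvPolynomial.algebraMap_eq]
  | add p q hp hq => simp only [map_add, mul_add, add_mul, hp, hq]; abel
  | mul_X p j hp =>
    rw [map_mul, ← mul_assoc, hp, commEval_X, add_mul, mul_assoc, hS j, Derivation.leibniz,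
      pderiv_X, map_add]
    simp only [smul_eq_mul, map_mul, commEval_X, mul_add, mul_assoc, ← mul_comm (pderiv i p)]
    by_cases h : i = j
    · subst h; simp; abel
    · simp [h, Ne.symm h]

theorem commEval_monomial_mem (T : Fin n → Module.End F M)
    (hT : ∀ i j, T i * T j = T j * T i) (W : ℕ → Submodule F M)
    (hW : ∀ i k, ∀ v ∈ W k, T i v ∈ W (k + 1)) (β : Fin n →₀ ℕ) :
    ∀ k, ∀ v ∈ W k, commEval T hT (monomial β (1 : F)) v ∈ W (k + ∑ i, β i) := by
  induction β using Finsupp.induction_linear with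
  | zero => intro k v hv; simpa using hv
  | add β γ hβ hγ =>
    intro k v hv
    have h := hβ _ _ (hγ _ _ hv)
    rw [← one_mul (1 : F), ← monomial_mul, map_mul]
    simpa [Finset.sum_add_distrib, add_assoc, add_comm, add_left_comm] using h
  | single i a =>
    intro k v hv
    rw [← X_pow_eq_monomial, map_pow, commEval_X]
    have : ∑ j, (Finsupp.single i a) j = a := by simp [Finsupp.single_apply]
    rw [this]
    clear this
    induction a with
    | zero => simpa using hv
    | succ a ih =>
      rw [pow_succ', ← add_assoc]
      exact hW _ _ _ ih

namespace WeylAction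

variable {X D : Fin n → Module.End F M}

/-- The normally ordered operator with a given symbol: the variables `inl i` stand for `X i`, the
variables `inr i` for `D i`. -/
noncomputable def op (h : WeylAction X D) : MvPolynomial (Fin n ⊕ Fin n) F →ₗ[F] Module.End F M :=
  (basisMonomials (Fin n ⊕ Fin n) F).constr F fun γ =>
    commEval X h.comm_X (monomial (Finsupp.sumFinsuppEquivProdFinsupp γ).1 (1 : F)) *
      commEval D h.comm_D (monomial (Finsupp.sumFinsuppEquivProdFinsupp γ).2 (1 : F))

theorem op_monomial (h : WeylAction X D) (γ : Fin n ⊕ Fin n →₀ ℕ) (c : F) :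
    h.op (monomial γ c) = c •
      (commEval X h.comm_X (monomial (Finsupp.sumFinsuppEquivProdFinsupp γ).1 (1 : F)) *
        commEval D h.comm_D (monomial (Finsupp.sumFinsuppEquivProdFinsupp γ).2 (1 : F))) := by
  have := (basisMonomials (Fin n ⊕ Fin n) F).constr_basis F (fun γ =>
    commEval X h.comm_X (monomial (Finsupp.sumFinsuppEquivProdFinsupp γ).1 (1 : F)) *
      commEval D h.comm_D (monomial (Finsupp.sumFinsuppEquivProdFinsupp γ).2 (1 : F))) γ
  rw [coe_basisMonomials] at this
  rw [← mul_one c, ← smul_eq_mul, ← smul_monomial, map_smul, op, this, smul_eq_mul, mul_one]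

theorem op_C (h : WeylAction X D) (c : F) : h.op (C c) = c • 1 := by
  have h1 : (Finsupp.sumFinsuppEquivProdFinsupp (0 : Fin n ⊕ Fin n →₀ ℕ)).1 = 0 := by ext; simp
  have h2 : (Finsupp.sumFinsuppEquivProdFinsupp (0 : Fin n ⊕ Fin n →₀ ℕ)).2 = 0 := by ext; simp
  rw [← monomial_zero', op_monomial, h1, h2]
  simp

theorem op_mul_X (h : WeylAction X D) (i : Fin n) (p : MvPolynomial (Fin n ⊕ Fin n) F) :
    h.op p * X i = X i * h.op p + h.op (pderiv (Sum.inr i) p) := by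
  induction p using MvPolynomial.induction_on' with
  | add p q hp hq => simp only [map_add, mul_add, add_mul, hp, hq]; abel
  | monomial γ c =>
    have h1 : (Finsupp.sumFinsuppEquivProdFinsupp (γ - Finsupp.single (Sum.inr i) 1)).1 =
        (Finsupp.sumFinsuppEquivProdFinsupp γ).1 := by ext; simp
    have h2 : (Finsupp.sumFinsuppEquivProdFinsupp (γ - Finsupp.single (Sum.inr i) 1)).2 =
        (Finsupp.sumFinsuppEquivProdFinsupp γ).2 - Finsupp.single i 1 := by
      ext j; simp [Finsupp.single_apply]
    have hX : ∀ q, commEval (F := F) X h.comm_X q * X i = X i * commEval X h.comm_X q := by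
      intro q
      rw [← commEval_X (F := F) X h.comm_X i, ← map_mul, ← map_mul, mul_comm]
    have key := mul_commEval (F := F) D h.comm_D (-X i) i (fun j => by
      have := h.D_mul_X j i
      rw [mul_neg, this, neg_mul]
      simp only [eq_comm (a := i)]
      abel)
      (monomial (Finsupp.sumFinsuppEquivProdFinsupp γ).2 (1 : F))
    rw [pderiv_monomial] at key
    rw [pderiv_monomial, op_monomial, op_monomial, h1, h2]
    have key' : commEval D h.comm_D (monomial (Finsupp.sumFinsuppEquivProdFinsupp γ).2 (1 : F)) *
        X i = X i * commEval D h.comm_D (monomial (Finsupp.sumFinsuppEquivProdFinsupp γ).2 (1 : F)) +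
          (γ (Sum.inr i) : F) • commEval D h.comm_D (monomial
            ((Finsupp.sumFinsuppEquivProdFinsupp γ).2 - Finsupp.single i 1) (1 : F)) := by
      rw [← map_smul, smul_monomial]
      simp only [neg_mul, mul_neg] at key
      simp only [Finsupp.snd_sumFinsuppEquivProdFinsupp, one_mul] at key
      simp only [smul_eq_mul, mul_one]
      rw [neg_eq_iff_eq_neg] at key
      rw [key]; abel
    rw [smul_mul_assoc, mul_assoc, key', mul_add, ← mul_assoc, hX, smul_add, mul_assoc,
      mul_smul_comm, mul_smul_comm, mul_smul]

theorem D_mul_op (h : WeylAction X D) (i : Fin n) (p : MvPolynomial (Fin n ⊕ Fin n) F) :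
    D i * h.op p = h.op p * D i + h.op (pderiv (Sum.inl i) p) := by
  induction p using MvPolynomial.induction_on' with
  | add p q hp hq => simp only [map_add, mul_add, add_mul, hp, hq]; abel
  | monomial γ c =>
    have h1 : (Finsupp.sumFinsuppEquivProdFinsupp (γ - Finsupp.single (Sum.inl i) 1)).2 =
        (Finsupp.sumFinsuppEquivProdFinsupp γ).2 := by ext; simp
    have h2 : (Finsupp.sumFinsuppEquivProdFinsupp (γ - Finsupp.single (Sum.inl i) 1)).1 =
        (Finsupp.sumFinsuppEquivProdFinsupp γ).1 - Finsupp.single i 1 := by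
      ext j; simp [Finsupp.single_apply]
    have hD : ∀ q, commEval (F := F) D h.comm_D q * D i = D i * commEval D h.comm_D q := by
      intro q
      rw [← commEval_X (F := F) D h.comm_D i, ← map_mul, ← map_mul, mul_comm]
    have key := mul_commEval (F := F) X h.comm_X (D i) i (h.D_mul_X i)
      (monomial (Finsupp.sumFinsuppEquivProdFinsupp γ).1 (1 : F))
    rw [pderiv_monomial, Finsupp.fst_sumFinsuppEquivProdFinsupp, one_mul, ← mul_one (Nat.cast _),
      ← smul_eq_mul (Nat.cast _), ← smul_monomial, map_smul] at key
    rw [pderiv_monomial, op_monomial, op_monomial, h1, h2]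
    rw [mul_smul_comm, ← mul_assoc, key, add_mul]
    simp only [smul_mul_assoc, smul_add, mul_smul, mul_assoc, hD]

theorem op_mem (h : WeylAction X D) (W : ℕ → Submodule F M) (hmono : Monotone W)
    (hX : ∀ i k, ∀ v ∈ W k, X i v ∈ W (k + 1)) (hD : ∀ i k, ∀ v ∈ W k, D i v ∈ W (k + 1))
    {γ : Fin n ⊕ Fin n →₀ ℕ} {k : ℕ} (hγ : ∑ v, γ v ≤ k) {a : ℕ} {v : M} (hv : v ∈ W a) :
    h.op (monomial γ 1) v ∈ W (a + k) := by
  have h1 := commEval_monomial_mem D h.comm_D W hD (Finsupp.sumFinsuppEquivProdFinsupp γ).2 a v hv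
  have h2 := commEval_monomial_mem X h.comm_X W hX (Finsupp.sumFinsuppEquivProdFinsupp γ).1 _ _ h1
  rw [op_monomial, one_smul]
  refine hmono ?_ h2
  rw [Fintype.sum_sum_type] at hγ
  simp only [Finsupp.fst_sumFinsuppEquivProdFinsupp, Finsupp.snd_sumFinsuppEquivProdFinsupp]
  omega

theorem eq_zero_of_op_eq_zero [CharZero F] (h : WeylAction X D) (W : ℕ → Submodule F M)
    (hX : ∀ i k, ∀ v ∈ W k, X i v ∈ W (k + 1)) (hD : ∀ i k, ∀ v ∈ W k, D i v ∈ W (k + 1))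
    {k₀ : ℕ} (hk₀ : W k₀ ≠ ⊥) (hmono : Monotone W) (k : ℕ) (p : MvPolynomial (Fin n ⊕ Fin n) F)
    (hp : ∀ γ : Fin n ⊕ Fin n →₀ ℕ, k < ∑ v, γ v → coeff γ p = 0)
    (h0 : ∀ v ∈ W (k₀ + k), h.op p v = 0) : p = 0 := by
  have const : ∀ p : MvPolynomial (Fin n ⊕ Fin n) F, (∀ γ, γ ≠ 0 → coeff γ p = 0) →
      (∀ v ∈ W k₀, h.op p v = 0) → p = 0 := by
    intro p hp h0
    have hpC : p = C (coeff 0 p) := by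
      ext γ
      by_cases hγ : γ = 0
      · simp [hγ]
      · rw [hp γ hγ, coeff_C, if_neg (Ne.symm hγ)]
    obtain ⟨v, hv, hv0⟩ := Submodule.exists_mem_ne_zero_of_ne_bot hk₀
    have := h0 v hv
    rw [hpC, op_C] at this
    have hc : coeff 0 p = 0 := by simpa [hv0] using this
    rw [hpC, hc, C_0]
  induction k generalizing p with
  | zero =>
    refine const p (fun γ hγ => hp γ ?_) h0
    obtain ⟨v, hv⟩ := Finsupp.ne_iff.1 hγ
    exact lt_of_lt_of_le (Nat.pos_of_ne_zero hv)
      (Finset.single_le_sum (f := fun v => γ v) (fun _ _ => Nat.zero_le _) (Finset.mem_univ v))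
  | succ k ih =>
    have hder : ∀ v, pderiv v p = 0 := by
      intro v
      refine ih _ (fun γ hγ => ?_) (fun w hw => ?_)
      · rw [coeff_pderiv, hp, zero_mul]
        simpa [Finset.sum_add_distrib, Finsupp.single_apply] using hγ
      · have hw' : h.op p w = 0 := h0 w (hmono (by omega) hw)
        cases v with
        | inl i =>
          have := LinearMap.congr_fun (h.D_mul_op i p) w
          simpa [hw', h0 _ (hD i _ w hw)] using this.symm
        | inr i =>
          have := LinearMap.congr_fun (h.op_mul_X i p) w
          simpa [hw', h0 _ (hX i _ w hw)] using this.symm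
    refine const p (fun γ hγ => ?_) (fun v hv => h0 v (hmono (by omega) hv))
    obtain ⟨v, hv⟩ := Finsupp.ne_iff.1 hγ
    have h1 := congrArg (coeff (γ - Finsupp.single v 1)) (hder v)
    rw [coeff_pderiv, coeff_zero, tsub_add_cancel_of_le
      (by simpa [Nat.one_le_iff_ne_zero] using hv)] at h1
    exact (mul_eq_zero.1 h1).resolve_right (Nat.cast_add_one_ne_zero _)

/-- Bernstein's inequality. -/
theorem pow_le_finrank [CharZero F] (h : WeylAction X D) (W : ℕ → Submodule F M)
    [∀ k, FiniteDimensional F (W k)] (hmono : Monotone W)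
    (hX : ∀ i k, ∀ v ∈ W k, X i v ∈ W (k + 1)) (hD : ∀ i k, ∀ v ∈ W k, D i v ∈ W (k + 1))
    {k₀ : ℕ} (hk₀ : W k₀ ≠ ⊥) (q : ℕ) :
    (q + 1) ^ n ≤ Module.finrank F (W (k₀ + 4 * n * q)) := by
  classical
  set k := 2 * n * q with hk
  let e : (Fin n ⊕ Fin n → Fin (q + 1)) → (Fin n ⊕ Fin n →₀ ℕ) := fun g =>
    Finsupp.equivFunOnFinite.symm fun v => (g v : ℕ)
  have he : Function.Injective e := fun g g' hg => by
    ext v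
    exact DFunLike.congr_fun hg v
  have hdeg : ∀ g, ∑ v, e g v ≤ k := fun g => by
    have : ∑ v, e g v ≤ ∑ _v : Fin n ⊕ Fin n, q :=
      Finset.sum_le_sum fun v _ => Nat.le_of_lt_succ (g v).2
    refine this.trans (le_of_eq ?_)
    simp only [Finset.sum_const, Finset.card_univ, Fintype.card_sum, Fintype.card_fin, smul_eq_mul,
      hk]
    ring
  let φ : (Fin n ⊕ Fin n → Fin (q + 1)) → (W (k₀ + k) →ₗ[F] W (k₀ + k + k)) := fun g =>
    (h.op (monomial (e g) 1)).restrict fun v hv => h.op_mem W hmono hX hD (hdeg g) hv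
  have hφ : LinearIndependent F φ := by
    rw [Fintype.linearIndependent_iff]
    intro c hc
    have hp := h.eq_zero_of_op_eq_zero W hX hD hk₀ hmono k (∑ g, monomial (e g) (c g)) ?_ ?_
    · intro g
      have := congrArg (coeff (e g)) hp
      simpa [coeff_sum, coeff_monomial, he.eq_iff] using this
    · intro γ hγ
      rw [coeff_sum]
      refine Finset.sum_eq_zero fun g _ => ?_
      rw [coeff_monomial, if_neg]
      rintro rfl
      exact absurd (hdeg g) (not_le.2 hγ)
    · intro v hv
      have := congrArg Subtype.val (LinearMap.congr_fun hc ⟨v, hv⟩)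
      simp only [LinearMap.sum_apply, LinearMap.smul_apply, Submodule.coe_sum, Submodule.coe_smul,
        LinearMap.zero_apply, Submodule.coe_zero] at this
      rw [map_sum, LinearMap.sum_apply, ← this]
      refine Finset.sum_congr rfl fun g _ => ?_
      rw [← mul_one (c g), ← smul_eq_mul, ← smul_monomial, map_smul, smul_eq_mul, mul_one]
      rfl
  have hcard := hφ.fintype_card_le_finrank
  rw [Module.finrank_linearMap] at hcard
  have hle : Module.finrank F (W (k₀ + k)) ≤ Module.finrank F (W (k₀ + k + k)) :=
    Submodule.finrank_mono (hmono (by omega))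
  have hkk : k₀ + k + k = k₀ + 4 * n * q := by rw [hk]; ring
  rw [← hkk]
  have h2 : ((q + 1) ^ n) ^ 2 ≤ (Module.finrank F (W (k₀ + k + k))) ^ 2 := by
    calc ((q + 1) ^ n) ^ 2 = Fintype.card (Fin n ⊕ Fin n → Fin (q + 1)) := by
          simp [← pow_mul, mul_two]
      _ ≤ _ := hcard
      _ ≤ _ := by rw [sq]; gcongr
  exact (Nat.pow_le_pow_iff_left two_ne_zero).1 h2

theorem mapQ (h : WeylAction X D) (N : Submodule F M) (hX : ∀ i, N ≤ N.comap (X i))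
    (hD : ∀ i, N ≤ N.comap (D i)) :
    WeylAction (fun i => N.mapQ N (X i) (hX i)) (fun i => N.mapQ N (D i) (hD i)) where
  comm_X i j := by
    ext v
    simpa using congrArg N.mkQ (LinearMap.congr_fun (h.comm_X i j) v)
  comm_D i j := by
    ext v
    simpa using congrArg N.mkQ (LinearMap.congr_fun (h.comm_D i j) v)
  D_mul_X i j := by
    ext v
    have := congrArg N.mkQ (LinearMap.congr_fun (h.D_mul_X i j) v)
    by_cases hij : i = j <;> simpa [hij] using this

theorem pow_add_finrank_inf_le [CharZero F] (h : WeylAction X D) (G : ℕ → Submodule F M)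
    [∀ k, FiniteDimensional F (G k)] (hmono : Monotone G)
    (hX : ∀ i k, ∀ v ∈ G k, X i v ∈ G (k + 1)) (hD : ∀ i k, ∀ v ∈ G k, D i v ∈ G (k + 1))
    {N N' : Submodule F M} (hN : N' ≤ N) (hNX : ∀ i, N ≤ N.comap (X i))
    (hND : ∀ i, N ≤ N.comap (D i)) (hNX' : ∀ i, N' ≤ N'.comap (X i))
    (hND' : ∀ i, N' ≤ N'.comap (D i)) {k₀ : ℕ} (hk₀ : ¬ G k₀ ⊓ N ≤ N') (q : ℕ) :
    (q + 1) ^ n + Module.finrank F (G (k₀ + 4 * n * q) ⊓ N' : Submodule F M) ≤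
      Module.finrank F (G (k₀ + 4 * n * q) ⊓ N : Submodule F M) := by
  have hfin : ∀ k, FiniteDimensional F (G k ⊓ N : Submodule F M) := fun k =>
    Submodule.finiteDimensional_of_le inf_le_left
  have hW := (h.mapQ N' hNX' hND').pow_le_finrank (fun k => (G k ⊓ N).map N'.mkQ)
    (fun a b hab => Submodule.map_mono (inf_le_inf_right _ (hmono hab)))
    (by
      rintro i k _ ⟨v, hv, rfl⟩
      exact ⟨X i v, ⟨hX i k v hv.1, hNX i hv.2⟩, by simp⟩)
    (by
      rintro i k _ ⟨v, hv, rfl⟩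
      exact ⟨D i v, ⟨hD i k v hv.1, hND i hv.2⟩, by simp⟩)
    (k₀ := k₀)
    (by rwa [Ne, eq_bot_iff, Submodule.map_le_iff_le_comap, Submodule.comap_bot,
      Submodule.ker_mkQ]) q
  set G₀ := G (k₀ + 4 * n * q)
  have hrank := (N'.mkQ.domRestrict (G₀ ⊓ N)).finrank_range_add_finrank_ker
  have hker : (LinearMap.ker (N'.mkQ.domRestrict (G₀ ⊓ N))).map (G₀ ⊓ N).subtype = G₀ ⊓ N' := by
    ext v
    simp only [Submodule.mem_map, LinearMap.mem_ker, LinearMap.domRestrict_apply,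
      Submodule.mkQ_apply, Submodule.Quotient.mk_eq_zero, Submodule.subtype_apply]
    constructor
    · rintro ⟨w, hw, rfl⟩
      exact ⟨w.2.1, hw⟩
    · rintro ⟨hv, hv'⟩
      exact ⟨⟨v, hv, hN hv'⟩, hv', rfl⟩
  rw [LinearMap.range_domRestrict, ← Submodule.finrank_map_subtype_eq _ (LinearMap.ker _),
    hker] at hrank
  omega

/-- A module with a good filtration of growth order `n` over the Weyl algebra in `n` variables
has no infinite strictly descending chain of submodules. -/
theorem exists_le_succ_of_antitone [CharZero F] (h : WeylAction X D) (G : ℕ → Submodule F M)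
    [∀ k, FiniteDimensional F (G k)] (hmono : Monotone G)
    (hX : ∀ i k, ∀ v ∈ G k, X i v ∈ G (k + 1)) (hD : ∀ i k, ∀ v ∈ G k, D i v ∈ G (k + 1))
    (c : ℕ) (hc : ∀ k, Module.finrank F (G k) ≤ c * (k + 1) ^ n)
    (N : ℕ → Submodule F M) (hN : Antitone N) (hNX : ∀ i j, N j ≤ (N j).comap (X i))
    (hND : ∀ i j, N j ≤ (N j).comap (D i)) (hNG : ∀ v ∈ N 0, ∃ k, v ∈ G k) :
    ∃ j, N j ≤ N (j + 1) := by
  by_contra! hcon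
  have hk : ∀ j, ∃ k, ¬ G k ⊓ N j ≤ N (j + 1) := fun j => by
    obtain ⟨v, hv, hv'⟩ := SetLike.not_le_iff_exists.1 (hcon j)
    obtain ⟨k, hk⟩ := hNG v (hN (Nat.zero_le j) hv)
    exact ⟨k, fun hle => hv' (hle ⟨hk, hv⟩)⟩
  choose κ hκ using hk
  set r := c * (4 * n + 1) ^ n + 1
  set k₀ := (Finset.range r).sup κ
  have hchain : ∀ j ≤ r, j * (k₀ + 1) ^ n +
      Module.finrank F (G (k₀ + 4 * n * k₀) ⊓ N j : Submodule F M) ≤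
        Module.finrank F (G (k₀ + 4 * n * k₀) ⊓ N 0 : Submodule F M) := by
    intro j hj
    induction j with
    | zero => simp
    | succ j ih =>
      have hj' : κ j ≤ k₀ := Finset.le_sup (f := κ) (Finset.mem_range.2 hj)
      have := h.pow_add_finrank_inf_le G hmono hX hD (hN (Nat.le_succ j)) (hNX · j) (hND · j)
        (hNX · (j + 1)) (hND · (j + 1)) (k₀ := k₀)
        (fun hle => hκ j ((inf_le_inf_right _ (hmono hj')).trans hle)) k₀
      have := ih (by omega)
      rw [add_mul, one_mul]
      simp only [Nat.succ_eq_add_one] at *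
      omega
  have h1 := hchain r le_rfl
  have h2 : Module.finrank F (G (k₀ + 4 * n * k₀) ⊓ N 0 : Submodule F M) ≤
      Module.finrank F (G (k₀ + 4 * n * k₀)) := Submodule.finrank_mono inf_le_left
  have h3 : r * (k₀ + 1) ^ n ≤ c * (4 * n + 1) ^ n * (k₀ + 1) ^ n :=
    calc r * (k₀ + 1) ^ n ≤ c * (k₀ + 4 * n * k₀ + 1) ^ n := by have := hc (k₀ + 4 * n * k₀); omega
      _ ≤ c * ((4 * n + 1) * (k₀ + 1)) ^ n := by gcongr; nlinarith
      _ = _ := by rw [mul_pow, mul_assoc]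
  have := Nat.le_of_mul_le_mul_right h3 (by positivity)
  omega

end WeylAction

end WeylAction

section DifferentialOperators

omit [CharZero K] in
theorem pd_mul_comm (i j : Fin n) : pd (K := K) i * pd j = pd j * pd i := by
  have h : ⁅(pderiv i : Derivation K (MvPolynomial (Fin n) K) (MvPolynomial (Fin n) K)),
      pderiv (R := K) j⁆ = 0 := by
    refine MvPolynomial.derivation_ext fun k => ?_
    classical
    rw [Derivation.commutator_apply]
    simp [pderiv_X, Pi.single_apply, apply_ite]
  refine LinearMap.ext fun p => ?_
  simpa [pd, Derivation.commutator_apply, sub_eq_zero] using Derivation.congr_fun h p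

omit [CharZero K] in
theorem dpow_eq_commEval (β : Fin n →₀ ℕ) :
    dpow (K := K) β = commEval pd pd_mul_comm (monomial β (1 : K)) := by
  have : (monomial β (1 : K)) = (List.ofFn fun i => MvPolynomial.X i ^ β i).prod := by
    rw [List.prod_ofFn, monomial_eq, C_1, one_mul, Finsupp.prod_fintype _ _ (by simp)]
  rw [this, map_list_prod, List.map_ofFn, dpow]
  congr 2
  ext1 i
  simp

omit [CharZero K] in
theorem dpow_zero : dpow (K := K) (0 : Fin n →₀ ℕ) = 1 := by
  rw [dpow_eq_commEval, ← C_apply, C_1, map_one]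

omit [CharZero K] in
theorem dpow_add_single (β : Fin n →₀ ℕ) (i : Fin n) :
    dpow (K := K) (β + Finsupp.single i 1) = pd i * dpow β := by
  rw [dpow_eq_commEval, dpow_eq_commEval, ← commEval_X (F := K) pd pd_mul_comm i, ← map_mul,
    MvPolynomial.X, monomial_mul, one_mul, add_comm]

omit [CharZero K] in
theorem totalDegree_pderiv_le (i : Fin n) (p : MvPolynomial (Fin n) K) :
    (pderiv i p).totalDegree ≤ p.totalDegree := by
  refine Finset.sup_le fun s hs => ?_
  rw [mem_support_iff, coeff_pderiv] at hs
  have := le_totalDegree (mem_support_iff.2 (left_ne_zero_of_mul hs))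
  rw [Finsupp.sum_add_index' (by simp) (by simp)] at this
  omega

/-- The value at the parameter `y` of the differential operator with coefficients `c`. -/
noncomputable def evalOp (c : (Fin n →₀ ℕ) →₀ Polynomial (MvPolynomial (Fin n) K)) (y : ℕ)
    (u : MvPolynomial (Fin n) K) : MvPolynomial (Fin n) K :=
  c.sum fun β cβ => Polynomial.eval (y : MvPolynomial (Fin n) K) cβ * dpow β u

omit [CharZero K] in
theorem evalOp_add (c c' : (Fin n →₀ ℕ) →₀ Polynomial (MvPolynomial (Fin n) K)) (y : ℕ)
    (u : MvPolynomial (Fin n) K) : evalOp (c + c') y u = evalOp c y u + evalOp c' y u :=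
  Finsupp.sum_add_index' (by simp) (by simp [add_mul])

omit [CharZero K] in
theorem evalOp_smul (q : Polynomial K) (c : (Fin n →₀ ℕ) →₀ Polynomial (MvPolynomial (Fin n) K))
    (y : ℕ) (u : MvPolynomial (Fin n) K) :
    evalOp (q.map (C : K →+* MvPolynomial (Fin n) K) • c) y u =
      C (q.eval (y : K)) * evalOp c y u := by
  rw [evalOp, Finsupp.sum_smul_index (by simp), evalOp, Finsupp.mul_sum]
  simp [Polynomial.eval_natCast_map, mul_assoc]

omit [CharZero K] in
theorem evalOp_single (β : Fin n →₀ ℕ) (g : MvPolynomial (Fin n) K) (y : ℕ)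
    (u : MvPolynomial (Fin n) K) :
    evalOp (Finsupp.single β (Polynomial.C g)) y u = g * dpow β u := by
  rw [evalOp, Finsupp.sum_single_index (by simp), Polynomial.eval_C]

omit [CharZero K] in
theorem evalOp_mapRange_comp (c : (Fin n →₀ ℕ) →₀ Polynomial (MvPolynomial (Fin n) K)) (j y : ℕ)
    (u : MvPolynomial (Fin n) K) :
    evalOp (c.mapRange (fun q => q.comp (Polynomial.X - (j : Polynomial (MvPolynomial (Fin n) K))))
      Polynomial.zero_comp) (y + j) u = evalOp c y u := by
  rw [evalOp, Finsupp.sum_mapRange_index (by simp), evalOp]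
  simp

end DifferentialOperators

section Germs

open Filter

variable (K n) in
/-- Germs at infinity of sequences of polynomials. -/
abbrev PolyGerm := Germ (atTop : Filter ℕ) (MvPolynomial (Fin n) K)

/-- The germ at infinity of a sequence of polynomials. -/
noncomputable def germ : (ℕ → MvPolynomial (Fin n) K) →+* PolyGerm K n := Germ.coeRingHom atTop

omit [CharZero K] in
theorem germ_eq_germ {u v : ℕ → MvPolynomial (Fin n) K} : germ u = germ v ↔ u =ᶠ[atTop] v :=
  Germ.coe_eq

omit [CharZero K] in
theorem germ_surjective : Function.Surjective (germ (K := K) (n := n)) := fun a =>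
  Germ.inductionOn a fun u => ⟨u, rfl⟩

/-- A univariate polynomial, viewed as the germ of the sequence of its values. -/
noncomputable def paramHom : Polynomial K →+* PolyGerm K n :=
  germ.comp (RingHom.pi fun m : ℕ => C.comp (Polynomial.evalRingHom (m : K)))

omit [CharZero K] in
theorem paramHom_apply (q : Polynomial K) :
    paramHom q = germ (n := n) fun m => C (q.eval (m : K)) := rfl

theorem eventually_eval_ne_zero {q : Polynomial K} (hq : q ≠ 0) :
    ∀ᶠ m : ℕ in atTop, q.eval (m : K) ≠ 0 := by
  rw [← Nat.cofinite_eq_atTop]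
  have hfin : {x | q.IsRoot x}.Finite := Polynomial.finite_setOfPred_isRoot hq
  exact (hfin.preimage (Nat.cast_injective (R := K)).injOn).subset fun m hm => by simpa using hm

theorem isUnit_paramHom {q : Polynomial K} (hq : q ≠ 0) : IsUnit (paramHom (n := n) q) := by
  refine IsUnit.of_mul_eq_one (germ fun m => C (q.eval (m : K))⁻¹) ?_
  rw [paramHom_apply, ← map_mul, ← map_one germ, germ_eq_germ]
  filter_upwards [eventually_eval_ne_zero hq] with m hm
  simp [← C_mul, hm]

/-- Rational functions of the parameter act on germs at infinity. -/
noncomputable instance : Algebra (FractionRing (Polynomial K)) (PolyGerm K n) :=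
  (IsLocalization.lift (M := nonZeroDivisors (Polynomial K)) (g := paramHom) fun y =>
    isUnit_paramHom (nonZeroDivisors.ne_zero y.2)).toAlgebra

theorem algebraMap_smul_polyGerm (q : Polynomial K) (a : PolyGerm K n) :
    algebraMap (Polynomial K) (FractionRing (Polynomial K)) q • a = paramHom q * a := by
  rw [Algebra.smul_def]
  congr 1
  exact IsLocalization.lift_eq _ q

theorem exists_paramHom_mul_smul (z : FractionRing (Polynomial K)) :
    ∃ p q : Polynomial K, q ≠ 0 ∧
      ∀ a : PolyGerm K n, paramHom q * (z • a) = paramHom p * a := by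
  obtain ⟨p, q, hq, rfl⟩ := IsFractionRing.div_surjective (Polynomial K) z
  have hq0 : q ≠ 0 := nonZeroDivisors.ne_zero hq
  refine ⟨p, q, hq0, fun a => ?_⟩
  rw [← algebraMap_smul_polyGerm, ← algebraMap_smul_polyGerm, smul_smul, mul_div_cancel₀]
  simpa using hq0

/-- Multiplication by `x_i` on germs of sequences of polynomials. -/
noncomputable def germX (i : Fin n) :
    Module.End (FractionRing (Polynomial K)) (PolyGerm K n) :=
  LinearMap.mulLeft _ (germ fun _ => MvPolynomial.X i)

@[simp]
theorem germX_germ (i : Fin n) (u : ℕ → MvPolynomial (Fin n) K) :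
    germX i (germ u) = germ fun m => MvPolynomial.X i * u m := by
  rw [germX, LinearMap.mulLeft_apply, ← map_mul]
  rfl

/-- Termwise partial differentiation on germs of sequences of polynomials. -/
noncomputable def germD (i : Fin n) :
    Module.End (FractionRing (Polynomial K)) (PolyGerm K n) where
  toFun a := a.map (pderiv i)
  map_add' a b := by
    obtain ⟨u, rfl⟩ := germ_surjective a
    obtain ⟨v, rfl⟩ := germ_surjective b
    exact congrArg germ (funext fun m => map_add (pderiv i) (u m) (v m))
  map_smul' z a := by
    have hparam : ∀ (q : Polynomial K) (b : PolyGerm K n),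
        (paramHom q * b).map (pderiv i) = paramHom q * b.map (pderiv i) := fun q b => by
      obtain ⟨v, rfl⟩ := germ_surjective b
      exact congrArg germ (funext fun m => pderiv_C_mul)
    obtain ⟨p, q, hq, h⟩ := exists_paramHom_mul_smul (n := n) z
    refine (isUnit_paramHom hq).mul_left_cancel ?_
    rw [RingHom.id_apply, h, ← hparam, h, hparam]

@[simp]
theorem germD_germ (i : Fin n) (u : ℕ → MvPolynomial (Fin n) K) :
    germD i (germ u) = germ fun m => pderiv i (u m) := rfl

theorem weylAction_germ : WeylAction (germX (K := K) (n := n)) germD where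
  comm_X i j := by
    ext a
    obtain ⟨u, rfl⟩ := germ_surjective a
    simp [mul_left_comm]
  comm_D i j := by
    ext a
    obtain ⟨u, rfl⟩ := germ_surjective a
    exact congrArg germ (funext fun m => LinearMap.congr_fun (pd_mul_comm i j) (u m))
  D_mul_X i j := by
    ext a
    obtain ⟨u, rfl⟩ := germ_surjective a
    by_cases h : i = j
    · subst h
      simp only [Module.End.mul_apply, germX_germ, germD_germ, if_true, LinearMap.add_apply,
        Module.End.one_apply, ← map_add]
      refine congrArg germ (funext fun m => ?_)
      simp [Derivation.leibniz]
    · simp [h, Derivation.leibniz, pderiv_X_of_ne (Ne.symm h)]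

theorem germ_dpow_mem {P : Submodule (FractionRing (Polynomial K)) (PolyGerm K n)}
    (hP : ∀ i, P ≤ P.comap (germD i)) {u : ℕ → MvPolynomial (Fin n) K} (hu : germ u ∈ P)
    (β : Fin n →₀ ℕ) : germ (fun m => dpow β (u m)) ∈ P := by
  induction β using Finsupp.induction₂ with
  | zero => simpa [dpow_zero] using hu
  | add_single i b β _ _ ih =>
    clear * - ih hP
    induction b with
    | zero => simpa using ih
    | succ b hb =>
      rw [Finsupp.single_add, ← add_assoc]
      simpa [dpow_add_single, pd] using hP i hb

theorem germ_mul_mem {P : Submodule (FractionRing (Polynomial K)) (PolyGerm K n)}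
    (hP : ∀ i, P ≤ P.comap (germX i)) (g : MvPolynomial (Fin n) K)
    {u : ℕ → MvPolynomial (Fin n) K} (hu : germ u ∈ P) : germ (fun m => g * u m) ∈ P := by
  induction g using MvPolynomial.induction_on generalizing u with
  | C a =>
    have := P.smul_mem (algebraMap (Polynomial K) _ (Polynomial.C a)) hu
    rw [algebraMap_smul_polyGerm, paramHom_apply, ← map_mul] at this
    simp only [Polynomial.eval_C] at this
    exact this
  | add p q hp hq =>
    have := P.add_mem (hp hu) (hq hu)
    rw [← map_add] at this
    simpa only [add_mul, Pi.add_def] using this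
  | mul_X p i hp =>
    have := hp (u := fun m => MvPolynomial.X i * u m) (by simpa using hP i hu)
    simpa only [mul_assoc] using this

end Germs

section Bernstein

open Filter

/-- The filtration of the module generated by the germ of the powers of `f`: its `k`-th step is
spanned by the germs `g * f ^ (m - k)` with `deg g ≤ (deg f + 1) * k`. -/
noncomputable def powerFiltration (f : MvPolynomial (Fin n) K) (k : ℕ) :
    Submodule (FractionRing (Polynomial K)) (PolyGerm K n) :=
  .span _ ((fun g => germ fun m => g * f ^ (m - k)) ''
    {g | g.totalDegree ≤ (f.totalDegree + 1) * k})

theorem germ_mem_powerFiltration {f g : MvPolynomial (Fin n) K} {k : ℕ}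
    (hg : g.totalDegree ≤ (f.totalDegree + 1) * k) {u : ℕ → MvPolynomial (Fin n) K}
    (hu : ∀ m, k ≤ m → u m = g * f ^ (m - k)) : germ u ∈ powerFiltration f k := by
  refine Submodule.subset_span ⟨g, hg, ?_⟩
  rw [germ_eq_germ]
  filter_upwards [eventually_ge_atTop k] with m hm
  exact (hu m hm).symm

theorem powerFiltration_monotone (f : MvPolynomial (Fin n) K) :
    Monotone (powerFiltration f) := by
  refine monotone_nat_of_le_succ fun k => Submodule.span_le.2 ?_
  rintro _ ⟨g, hg, rfl⟩
  refine germ_mem_powerFiltration (g := g * f) ?_ fun m hm => ?_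
  · have := totalDegree_mul g f
    have : g.totalDegree ≤ (f.totalDegree + 1) * k := hg
    rw [mul_add_one]
    omega
  · rw [mul_assoc, ← pow_succ', show m - (k + 1) + 1 = m - k by omega]

theorem powerFiltration_germX (f : MvPolynomial (Fin n) K) (i : Fin n) (k : ℕ) :
    powerFiltration f k ≤ (powerFiltration f (k + 1)).comap (germX i) := by
  refine Submodule.span_le.2 ?_
  rintro _ ⟨g, hg, rfl⟩
  simp only [SetLike.mem_coe, Submodule.mem_comap, germX_germ]
  refine germ_mem_powerFiltration (g := MvPolynomial.X i * (g * f)) ?_ fun m hm => ?_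
  · have h₁ := totalDegree_mul g f
    have h₂ := totalDegree_mul (MvPolynomial.X i) (g * f)
    rw [totalDegree_X] at h₂
    have : g.totalDegree ≤ (f.totalDegree + 1) * k := hg
    rw [mul_add_one]
    omega
  · rw [mul_assoc, mul_assoc, ← pow_succ', show m - (k + 1) + 1 = m - k by omega]

theorem powerFiltration_germD (f : MvPolynomial (Fin n) K) (i : Fin n) (k : ℕ) :
    powerFiltration f k ≤ (powerFiltration f (k + 1)).comap (germD i) := by
  refine Submodule.span_le.2 ?_
  rintro _ ⟨g, hg, rfl⟩
  simp only [SetLike.mem_coe, Submodule.mem_comap, germD_germ]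
  have hg' : g.totalDegree ≤ (f.totalDegree + 1) * k := hg
  have h₁ : germ (fun m => pderiv i g * f * f ^ (m - (k + 1))) ∈ powerFiltration f (k + 1) := by
    refine germ_mem_powerFiltration (g := pderiv i g * f) ?_ fun m _ => rfl
    have := totalDegree_mul (pderiv i g) f
    have := totalDegree_pderiv_le i g
    rw [mul_add_one]
    omega
  have h₂ : germ (fun m => g * pderiv i f * f ^ (m - (k + 1))) ∈ powerFiltration f (k + 1) := by
    refine germ_mem_powerFiltration (g := g * pderiv i f) ?_ fun m _ => rfl
    have := totalDegree_mul g (pderiv i f)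
    have := totalDegree_pderiv_le i f
    rw [mul_add_one]
    omega
  have h₃ := add_mem h₁ (Submodule.smul_mem _
    (algebraMap (Polynomial K) _ (Polynomial.X - Polynomial.C (k : K))) h₂)
  rw [algebraMap_smul_polyGerm, paramHom_apply, ← map_mul, ← map_add] at h₃
  convert h₃ using 1
  rw [germ_eq_germ]
  filter_upwards [eventually_ge_atTop (k + 1)] with m hm
  obtain ⟨l, rfl⟩ := Nat.exists_eq_add_of_le hm
  have h₄ : k + 1 + l - k = l + 1 := by omega
  simp only [Pi.add_apply, Pi.mul_apply, add_tsub_cancel_left, h₄, Derivation.leibniz,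
    Derivation.leibniz_pow, smul_eq_mul, nsmul_eq_mul, add_tsub_cancel_right, Polynomial.eval_sub,
    Polynomial.eval_X, Polynomial.eval_natCast, map_sub, map_natCast, Nat.cast_add, Nat.cast_one]
  ring

theorem powerFiltration_le_span (f : MvPolynomial (Fin n) K) (k : ℕ) :
    powerFiltration f k ≤ Submodule.span _
      (Set.range fun α : Fin n → Fin ((f.totalDegree + 1) * k + 1) =>
        germ fun m => monomial (Finsupp.equivFunOnFinite.symm fun i => (α i : ℕ)) (1 : K) *
          f ^ (m - k)) := by
  refine Submodule.span_le.2 ?_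
  rintro _ ⟨g, hg, rfl⟩
  have hsum : (germ fun m => g * f ^ (m - k)) = ∑ s ∈ g.support,
      algebraMap (Polynomial K) (FractionRing (Polynomial K)) (Polynomial.C (coeff s g)) •
        germ fun m => monomial s (1 : K) * f ^ (m - k) := by
    simp_rw [algebraMap_smul_polyGerm, paramHom_apply, ← map_mul, ← map_sum]
    congr 1
    ext1 m
    simp only [Finset.sum_apply, Pi.mul_apply, Polynomial.eval_C, ← mul_assoc, C_mul_monomial,
      mul_one, ← Finset.sum_mul]
    rw [support_sum_monomial_coeff]
  simp only [SetLike.mem_coe]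
  rw [hsum]
  refine Submodule.sum_mem _ fun s hs => Submodule.smul_mem _ _ (Submodule.subset_span ?_)
  have hle (i : Fin n) : s i < (f.totalDegree + 1) * k + 1 := by
    have h₁ := le_totalDegree hs
    have h₂ : s i ≤ s.sum fun _ e => e := by
      rw [Finsupp.sum_fintype _ _ fun _ => rfl]
      exact Finset.single_le_sum (fun _ _ => Nat.zero_le _) (Finset.mem_univ i)
    have : g.totalDegree ≤ (f.totalDegree + 1) * k := hg
    omega
  refine ⟨fun i => ⟨s i, hle i⟩, ?_⟩
  congr!
  ext i
  simp

instance finiteDimensional_powerFiltration (f : MvPolynomial (Fin n) K) (k : ℕ) :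
    FiniteDimensional (FractionRing (Polynomial K)) (powerFiltration f k) := by
  have := FiniteDimensional.span_of_finite (FractionRing (Polynomial K)) (Set.finite_range
    fun α : Fin n → Fin ((f.totalDegree + 1) * k + 1) =>
        germ fun m => monomial (Finsupp.equivFunOnFinite.symm fun i => (α i : ℕ)) (1 : K) *
          f ^ (m - k))
  exact Submodule.finiteDimensional_of_le (powerFiltration_le_span f k)

theorem finrank_powerFiltration_le (f : MvPolynomial (Fin n) K) (k : ℕ) :
    Module.finrank (FractionRing (Polynomial K)) (powerFiltration f k) ≤
      (f.totalDegree + 1) ^ n * (k + 1) ^ n := by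
  have := FiniteDimensional.span_of_finite (FractionRing (Polynomial K)) (Set.finite_range
    fun α : Fin n → Fin ((f.totalDegree + 1) * k + 1) =>
        germ fun m => monomial (Finsupp.equivFunOnFinite.symm fun i => (α i : ℕ)) (1 : K) *
          f ^ (m - k))
  refine (Submodule.finrank_mono (powerFiltration_le_span f k)).trans
    ((finrank_range_le_card _).trans ?_)
  rw [Fintype.card_fun, Fintype.card_fin, Fintype.card_fin, ← mul_pow]
  gcongr
  rw [mul_add_one]
  omega

/-- The submodule generated, over the differential operators, by the germ of `f ^ (m + j)`. -/
noncomputable def powerModule (f : MvPolynomial (Fin n) K) (j : ℕ) :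
    Submodule (FractionRing (Polynomial K)) (PolyGerm K n) :=
  .span _ (Set.range fun p : MvPolynomial (Fin n) K × (Fin n →₀ ℕ) =>
    germ fun m => p.1 * dpow p.2 (f ^ (m + j)))

theorem germ_pow_mem_powerModule (f : MvPolynomial (Fin n) K) (j : ℕ) :
    germ (fun m => f ^ (m + j)) ∈ powerModule f j :=
  Submodule.subset_span ⟨((1 : MvPolynomial (Fin n) K), 0), by simp [dpow_zero]⟩

theorem powerModule_germX (f : MvPolynomial (Fin n) K) (i : Fin n) (j : ℕ) :
    powerModule f j ≤ (powerModule f j).comap (germX i) := by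
  refine Submodule.span_le.2 ?_
  rintro _ ⟨⟨g, β⟩, rfl⟩
  exact Submodule.subset_span ⟨(MvPolynomial.X i * g, β), by simp [mul_assoc]⟩

theorem powerModule_germD (f : MvPolynomial (Fin n) K) (i : Fin n) (j : ℕ) :
    powerModule f j ≤ (powerModule f j).comap (germD i) := by
  refine Submodule.span_le.2 ?_
  rintro _ ⟨⟨g, β⟩, rfl⟩
  have h := (powerModule f j).add_mem (Submodule.subset_span ⟨(g, β + Finsupp.single i 1), rfl⟩)
    (Submodule.subset_span ⟨(pderiv i g, β), rfl⟩)
  rw [← map_add] at h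
  simp only [SetLike.mem_coe, Submodule.mem_comap, germD_germ]
  convert h using 1
  congr 1
  ext1 m
  simp [dpow_add_single, pd, Derivation.leibniz, mul_comm]

theorem powerModule_le {P : Submodule (FractionRing (Polynomial K)) (PolyGerm K n)}
    (hX : ∀ i, P ≤ P.comap (germX i)) (hD : ∀ i, P ≤ P.comap (germD i))
    {f : MvPolynomial (Fin n) K} {j : ℕ} (hf : germ (fun m => f ^ (m + j)) ∈ P) :
    powerModule f j ≤ P := by
  refine Submodule.span_le.2 ?_
  rintro _ ⟨⟨g, β⟩, rfl⟩
  exact germ_mul_mem hX g (germ_dpow_mem hD hf β)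

theorem powerModule_antitone (f : MvPolynomial (Fin n) K) : Antitone (powerModule f) := by
  refine antitone_nat_of_succ_le fun j =>
    powerModule_le (fun i => powerModule_germX f i j) (fun i => powerModule_germD f i j) ?_
  simpa only [← pow_succ', add_assoc] using
    germ_mul_mem (fun i => powerModule_germX f i j) f (germ_pow_mem_powerModule f j)

theorem exists_mem_powerFiltration (f : MvPolynomial (Fin n) K) :
    ∀ v ∈ powerModule f 0, ∃ k, v ∈ powerFiltration f k := by
  have hdir := (powerFiltration_monotone f).directed_le
  have key : powerModule f 0 ≤ ⨆ k, powerFiltration f k := by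
    refine powerModule_le (fun i v hv => ?_) (fun i v hv => ?_) ?_
    · obtain ⟨k, hk⟩ := (Submodule.mem_iSup_of_directed _ hdir).1 hv
      exact (Submodule.mem_iSup_of_directed _ hdir).2 ⟨k + 1, powerFiltration_germX f i k hk⟩
    · obtain ⟨k, hk⟩ := (Submodule.mem_iSup_of_directed _ hdir).1 hv
      exact (Submodule.mem_iSup_of_directed _ hdir).2 ⟨k + 1, powerFiltration_germD f i k hk⟩
    · exact (Submodule.mem_iSup_of_directed _ hdir).2
        ⟨0, germ_mem_powerFiltration (g := 1) (by simp) (by simp)⟩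
  exact fun v hv => (Submodule.mem_iSup_of_directed _ hdir).1 (key hv)

theorem exists_germ_pow_mem_powerModule_succ (f : MvPolynomial (Fin n) K) :
    ∃ j, germ (fun m => f ^ (m + j)) ∈ powerModule f (j + 1) := by
  obtain ⟨j, hj⟩ := weylAction_germ.exists_le_succ_of_antitone (powerFiltration f)
    (powerFiltration_monotone f) (fun i k _ hv => powerFiltration_germX f i k hv)
    (fun i k _ hv => powerFiltration_germD f i k hv) ((f.totalDegree + 1) ^ n)
    (finrank_powerFiltration_le f) (powerModule f) (powerModule_antitone f)
    (powerModule_germX f) (powerModule_germD f) (exists_mem_powerFiltration f)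
  exact ⟨j, hj (germ_pow_mem_powerModule f j)⟩

theorem exists_evalOp_of_mem_powerModule (f : MvPolynomial (Fin n) K) (j : ℕ) :
    ∀ v ∈ powerModule f j, ∃ b : Polynomial K, b ≠ 0 ∧
      ∃ c : (Fin n →₀ ℕ) →₀ Polynomial (MvPolynomial (Fin n) K),
        paramHom b * v = germ fun m => evalOp c m (f ^ (m + j)) := by
  intro v hv
  induction hv using Submodule.span_induction with
  | mem v hv =>
    obtain ⟨⟨g, β⟩, rfl⟩ := hv
    exact ⟨1, one_ne_zero, Finsupp.single β (Polynomial.C g), by simp [evalOp_single]⟩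
  | zero => exact ⟨1, one_ne_zero, 0, (mul_zero _).trans (map_zero germ).symm⟩
  | add v w _ _ hv hw =>
    obtain ⟨b, hb, c, hv⟩ := hv
    obtain ⟨b', hb', c', hw⟩ := hw
    refine ⟨b * b', mul_ne_zero hb hb', b'.map (C : K →+* MvPolynomial (Fin n) K) • c +
      b.map (C : K →+* MvPolynomial (Fin n) K) • c', ?_⟩
    have : paramHom (b * b') * (v + w) =
        paramHom b' * (paramHom b * v) + paramHom b * (paramHom b' * w) := by
      rw [map_mul]
      ring
    rw [this, hv, hw, paramHom_apply, paramHom_apply, ← map_mul, ← map_mul, ← map_add]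
    exact congrArg germ (funext fun m => by simp [evalOp_add, evalOp_smul])
  | smul z v _ hv =>
    obtain ⟨b, hb, c, hv⟩ := hv
    obtain ⟨p, q, hq, h⟩ := exists_paramHom_mul_smul (n := n) z
    refine ⟨b * q, mul_ne_zero hb hq, p.map (C : K →+* MvPolynomial (Fin n) K) • c, ?_⟩
    rw [map_mul, mul_assoc, h, mul_left_comm, hv, paramHom_apply, ← map_mul]
    exact congrArg germ (funext fun m => by simp [evalOp_smul])

theorem exists_eventually_evalOp (f : MvPolynomial (Fin n) K) :
    ∃ j : ℕ, ∃ b : Polynomial K, b ≠ 0 ∧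
      ∃ c : (Fin n →₀ ℕ) →₀ Polynomial (MvPolynomial (Fin n) K),
        ∀ᶠ m : ℕ in atTop, evalOp c m (f ^ (m + (j + 1))) = C (b.eval (m : K)) * f ^ (m + j) := by
  obtain ⟨j, hj⟩ := exists_germ_pow_mem_powerModule_succ f
  obtain ⟨b, hb, c, h⟩ := exists_evalOp_of_mem_powerModule f (j + 1) _ hj
  rw [paramHom_apply, ← map_mul, germ_eq_germ] at h
  exact ⟨j, b, hb, c, h.symm⟩

end Bernstein

/-- Theorem 6.4 (Bernstein's theorem), integer-specialized form: for nonzero `f` there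
exist a nonzero `b ∈ K[X]` and a finitely supported `c : (Fin n →₀ ℕ) →₀ R[Y]`
(encoding `P(s) = Σ_β c_β(x,s)·∂^β`) such that for every `m ∈ ℕ`,
`Σ_β c_β(m) · ∂^β(f^{m+1}) = b(m) · f^m` holds in `R`. -/
theorem bernstein_sato_exists (hn : 0 < n)
    (f : MvPolynomial (Fin n) K) (hf : f ≠ 0) :
    ∃ b : Polynomial K, b ≠ 0 ∧
      ∃ c : (Fin n →₀ ℕ) →₀ Polynomial (MvPolynomial (Fin n) K),
        ∀ m : ℕ,
          (c.sum fun β cβ =>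
              Polynomial.eval ((m : MvPolynomial (Fin n) K)) cβ * dpow β (f ^ (m + 1))) =
            C (Polynomial.eval (m : K) b) * f ^ m := by
  obtain ⟨j, b, hb, c, h⟩ := exists_eventually_evalOp f
  obtain ⟨m₀, h⟩ := Filter.eventually_atTop.1 h
  set P : Polynomial K := ∏ i ∈ Finset.range (m₀ + j), (Polynomial.X - Polynomial.C (i : K)) with hP
  have hP0 : P ≠ 0 := (Polynomial.monic_prod_X_sub_C _ _).ne_zero
  refine ⟨P * b.comp (Polynomial.X - Polynomial.C (j : K)), mul_ne_zero hP0 ?_,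
    P.map (C : K →+* MvPolynomial (Fin n) K) • c.mapRange
      (fun q => q.comp (Polynomial.X - (j : Polynomial (MvPolynomial (Fin n) K))))
      Polynomial.zero_comp, fun m => ?_⟩
  · rw [sub_eq_add_neg, ← Polynomial.C_neg]
    exact Polynomial.comp_X_add_C_ne_zero_iff.2 hb
  · change evalOp _ m _ = _
    rw [evalOp_smul, Polynomial.eval_mul, C_mul, mul_assoc]
    obtain hm | hm := lt_or_ge m (m₀ + j)
    · have : P.eval (m : K) = 0 := by
        rw [hP, Polynomial.eval_prod]
        exact Finset.prod_eq_zero (Finset.mem_range.2 hm) (by simp)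
      simp [this]
    · obtain ⟨l, rfl⟩ := Nat.exists_eq_add_of_le' (le_of_add_le_right hm)
      rw [evalOp_mapRange_comp, add_assoc l j 1, h l (by omega)]
      simp
end

section
/- (Key step in the proof of Lemma 4.2: R ≅ D⧸⟨∂_1,…,∂_n⟩ as left D-modules.) The map ε : D → R sending an operator P to P(1) (application to the constant polynomial 1) is surjective, and for P ∈ D one has ε(P) = 0 if and only if P belongs to the left ideal of D generated by ∂_1,…,∂_n. Consequently ε induces an isomorphism of left D-modules D⧸⟨∂_1,…,∂_n⟩ ≅ R, where D acts on R by applying endomorphisms. -/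
open MvPolynomial

set_option synthInstance.maxHeartbeats 1000000
set_option maxHeartbeats 1000000

variable {K : Type*} [Field K] [CharZero K] {n : ℕ}

/-- The multiplication-by-`g` endomorphism of `R = K[x_1,…,x_n]`. -/
noncomputable def mulOp (g : MvPolynomial (Fin n) K) :
    Module.End K (MvPolynomial (Fin n) K) :=
  LinearMap.mulLeft K g

/-- The operator realization `D` of the `n`-th Weyl algebra: the subalgebra of
`End_K(R)` generated by the multiplication operators `mul(x_i)` and the partial
derivatives `∂_i`. -/
noncomputable def weylD (K : Type*) [Field K] [CharZero K] (n : ℕ) :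
    Subalgebra K (Module.End K (MvPolynomial (Fin n) K)) :=
  Algebra.adjoin K
    ((Set.range fun i : Fin n => mulOp (X i)) ∪ Set.range (pd (K := K) (n := n)))

lemma pd_mem_weylD (i : Fin n) : pd i ∈ weylD K n :=
  Algebra.subset_adjoin (Set.mem_union_right _ ⟨i, rfl⟩)

/-- The left ideal `⟨∂_1,…,∂_n⟩` of `D`, i.e. the `D`-submodule of `D` spanned by the
partial derivative operators, `D` acting on itself by left multiplication. -/
noncomputable def Jpd (K : Type*) [Field K] [CharZero K] (n : ℕ) :
    Submodule (weylD K n) (weylD K n) :=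
  Submodule.span (weylD K n)
    (Set.range fun i : Fin n => (⟨pd i, pd_mem_weylD i⟩ : weylD K n))

noncomputable instance :
    HasQuotient (↥(weylD K n)) (Submodule ↥(weylD K n) ↥(weylD K n)) :=
  Submodule.hasQuotient (R := ↥(weylD K n)) (M := ↥(weylD K n))

lemma exists_quotient_linearEquiv {A M N : Type*} [Ring A] [AddCommGroup M] [Module A M]
    [AddCommGroup N] [Module A N] {f : M →ₗ[A] N} (hf : Function.Surjective f)
    {J : Submodule A M} (hJ : LinearMap.ker f = J) :
    ∃ e : (M ⧸ J) ≃ₗ[A] N, ∀ m : M, e (Submodule.Quotient.mk m) = f m := by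
  subst hJ
  exact ⟨f.quotKerEquivOfSurjective hf, fun _ => rfl⟩

lemma mulOp_apply (f g : MvPolynomial (Fin n) K) : mulOp f g = f * g := rfl

lemma pd_apply (i : Fin n) (g : MvPolynomial (Fin n) K) : pd i g = pderiv i g := rfl

lemma mulOp_mem_weylD (g : MvPolynomial (Fin n) K) : mulOp g ∈ weylD K n := by
  induction g using MvPolynomial.induction_on with
  | C a =>
    convert (weylD K n).algebraMap_mem a using 1
    refine LinearMap.ext fun p => ?_
    simp [mulOp_apply, C_mul', Module.algebraMap_end_apply]
  | add p q hp hq =>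
    convert (weylD K n).add_mem hp hq using 1
    refine LinearMap.ext fun r => ?_
    simp [mulOp_apply, add_mul]
  | mul_X p i hp =>
    convert (weylD K n).mul_mem hp
      (Algebra.subset_adjoin (Set.mem_union_left _ ⟨i, rfl⟩) : mulOp (X i) ∈ weylD K n) using 1
    refine LinearMap.ext fun r => ?_
    simp [mulOp_apply, mul_assoc]

/-- Multiplication by `g`, as an element of the Weyl algebra. -/
noncomputable def weylMul (g : MvPolynomial (Fin n) K) : weylD K n :=
  ⟨mulOp g, mulOp_mem_weylD g⟩

lemma coe_weylMul_apply (f g : MvPolynomial (Fin n) K) :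
    (weylMul f : Module.End K (MvPolynomial (Fin n) K)) g = f * g := rfl

lemma weylD_ext {P Q : weylD K n}
    (h : ∀ g, (P : Module.End K (MvPolynomial (Fin n) K)) g =
      (Q : Module.End K (MvPolynomial (Fin n) K)) g) : P = Q :=
  Subtype.ext (LinearMap.ext h)

lemma mul_mem_Jpd (P : weylD K n) {Q : weylD K n} (hQ : Q ∈ Jpd K n) : P * Q ∈ Jpd K n :=
  (Jpd K n).smul_mem P hQ

lemma mul_weylMul_sub_mem_Jpd (P : weylD K n) (g : MvPolynomial (Fin n) K) :
    P * weylMul g - weylMul ((P : Module.End K (MvPolynomial (Fin n) K)) g) ∈ Jpd K n := by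
  obtain ⟨P, hP⟩ := P
  induction hP using Algebra.adjoin_induction generalizing g with
  | mem P hP =>
    rcases hP with ⟨i, rfl⟩ | ⟨i, rfl⟩
    · convert (Jpd K n).zero_mem using 1
      refine weylD_ext fun p => ?_
      simp [coe_weylMul_apply, mulOp_apply, mul_assoc]
    · convert mul_mem_Jpd (weylMul g) (Submodule.subset_span ⟨i, rfl⟩ :
        (⟨pd i, pd_mem_weylD i⟩ : weylD K n) ∈ Jpd K n) using 1
      refine weylD_ext fun p => ?_
      simp [coe_weylMul_apply, pd_apply, mul_comm]
  | algebraMap a =>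
    convert (Jpd K n).zero_mem using 1
    refine weylD_ext fun p => ?_
    simp [coe_weylMul_apply, Module.algebraMap_end_apply]
  | add P Q hP hQ ihP ihQ =>
    convert (Jpd K n).add_mem (ihP g) (ihQ g) using 1
    refine weylD_ext fun p => ?_
    simp [coe_weylMul_apply, add_mul]
    ring
  | mul P Q hP hQ ihP ihQ =>
    convert (Jpd K n).add_mem (mul_mem_Jpd ⟨P, hP⟩ (ihQ g)) (ihP (Q g)) using 1
    refine weylD_ext fun p => ?_
    simp [coe_weylMul_apply]

/-- The `D`-linear map `D → R` applying an operator to the constant polynomial `1`. -/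
noncomputable def weylEval (K : Type*) [Field K] [CharZero K] (n : ℕ) :
    weylD K n →ₗ[weylD K n] MvPolynomial (Fin n) K :=
  LinearMap.toSpanSingleton (weylD K n) (MvPolynomial (Fin n) K) 1

lemma weylEval_apply (P : weylD K n) :
    weylEval K n P = (P : Module.End K (MvPolynomial (Fin n) K)) 1 := rfl

lemma weylEval_surjective : Function.Surjective (weylEval K n) := fun g =>
  ⟨weylMul g, by rw [weylEval_apply, coe_weylMul_apply, mul_one]⟩

lemma ker_weylEval : LinearMap.ker (weylEval K n) = Jpd K n := by
  refine le_antisymm (fun P hP => ?_) (Submodule.span_le.2 ?_)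
  · rw [LinearMap.mem_ker, weylEval_apply] at hP
    convert mul_weylMul_sub_mem_Jpd P 1 using 1
    refine weylD_ext fun p => ?_
    simp [hP, coe_weylMul_apply]
  · rintro _ ⟨i, rfl⟩
    exact (pderiv i).map_one_eq_zero

/-- Key step in the proof of Lemma 4.2: the map `ε : D → R`, `P ↦ P(1)`, is surjective,
its vanishing locus is exactly the left ideal `⟨∂_1,…,∂_n⟩`, and consequently `ε`
induces an isomorphism of left `D`-modules `D⧸⟨∂_1,…,∂_n⟩ ≅ R` (where `D` acts on `R`
by applying endomorphisms). -/
theorem weylD_apply_one_surjective_and_ker (hn : 0 < n) :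
    (Function.Surjective fun P : weylD K n =>
      (P : Module.End K (MvPolynomial (Fin n) K)) 1) ∧
    (∀ P : weylD K n,
      (P : Module.End K (MvPolynomial (Fin n) K)) 1 = 0 ↔ P ∈ Jpd K n) ∧
    ∃ e : (weylD K n ⧸ Jpd K n) ≃ₗ[weylD K n] MvPolynomial (Fin n) K,
      ∀ P : weylD K n,
        e (Submodule.Quotient.mk P) = (P : Module.End K (MvPolynomial (Fin n) K)) 1 := by
  refine ⟨weylEval_surjective, fun P => ?_, ?_⟩
  · rw [← ker_weylEval, LinearMap.mem_ker, weylEval_apply]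
  · have h := exists_quotient_linearEquiv (A := weylD K n) (M := weylD K n)
      (N := MvPolynomial (Fin n) K) (f := weylEval K n) (J := Jpd K n)
      weylEval_surjective ker_weylEval
    exact h
end

section
/- (Lemma 8.2, the higher-derivative formula for powers, specialized at integer exponents and written over ordered tuples.) Let f ∈ R, let β : Fin n →₀ ℕ be nonzero, write |β| := Σ_i β(i), and let m ∈ ℕ with m ≥ |β|. Then ∂^β(f^m) = Σ_{k=1}^{|β|} C(m,k) · Σ_σ (β! / (σ_1!⋯σ_k!)) · (∏_{i=1}^{k} ∂^{σ_i} f) · f^{m−k}, where C(m,k) is the binomial coefficient, the inner sum ranges over all ordered k-tuples σ = (σ_1,…,σ_k) of nonzero elements of Fin n →₀ ℕ with σ_1 + … + σ_k = β, the factorial γ! of a multi-index γ means ∏_i γ(i)!, and β!/(σ_1!⋯σ_k!) is the (integral) multinomial coefficient. (Each unordered partition of β of length k in the sense of Lemma 8.2 is counted here once for each of its orderings.) -/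
open MvPolynomial

variable {K : Type*} [Field K] [CharZero K] {n : ℕ}

/-- The Taylor homomorphism `f ↦ f(x + y)`, with values in the polynomials in `y` over `A[x]`. -/
noncomputable def taylorHom {τ A : Type*} [CommSemiring A] :
    MvPolynomial τ A →+* MvPolynomial τ (MvPolynomial τ A) :=
  eval₂Hom (C.comp C) fun i => C (X i) + X i

theorem taylorHom_X {τ A : Type*} [CommSemiring A] (i : τ) :
    taylorHom (X i : MvPolynomial τ A) = C (X i) + X i := by
  simp [taylorHom]

theorem coeff_zero_taylorHom {τ A : Type*} [CommSemiring A] (f : MvPolynomial τ A) :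
    coeff 0 (taylorHom f) = f := by
  have h : (constantCoeff.comp taylorHom : MvPolynomial τ A →+* _) = RingHom.id _ := by
    ext i <;> simp [taylorHom]
  exact congrArg (· f) h

theorem pderiv_taylorHom {τ A : Type*} [CommSemiring A] (i : τ) (f : MvPolynomial τ A) :
    pderiv i (taylorHom f) = taylorHom (pderiv i f) := by
  induction f using MvPolynomial.induction_on with
  | C a => simp [taylorHom]
  | add p q hp hq => simp [hp, hq]
  | mul_X p j hp =>
    by_cases hij : j = i
    · subst hij
      simp [Derivation.leibniz, hp, taylorHom_X]
    · simp [Derivation.leibniz, hp, taylorHom_X, pderiv_X_of_ne hij]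

theorem prod_factorial_add_single (γ : Fin n →₀ ℕ) (i : Fin n) :
    ∏ j, ((γ + Finsupp.single i 1 : Fin n →₀ ℕ) j).factorial =
      (γ i + 1) * ∏ j, (γ j).factorial := by
  rw [← Finset.mul_prod_erase _ _ (Finset.mem_univ i),
    ← Finset.mul_prod_erase _ (fun j => (γ j).factorial) (Finset.mem_univ i), ← mul_assoc]
  congr 1
  · simp [Nat.factorial_succ]
  · refine Finset.prod_congr rfl fun j hj => ?_
    simp [Finsupp.single_eq_of_ne (Finset.ne_of_mem_erase hj)]

theorem factorial_mul_coeff_taylorHom_pderiv {A : Type*} [CommSemiring A] (γ : Fin n →₀ ℕ)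
    (i : Fin n) (f : MvPolynomial (Fin n) A) :
    ((∏ j, (γ j).factorial : ℕ) : MvPolynomial (Fin n) A) * coeff γ (taylorHom (pderiv i f)) =
      ((∏ j, ((γ + Finsupp.single i 1 : Fin n →₀ ℕ) j).factorial : ℕ) :
        MvPolynomial (Fin n) A) * coeff (γ + Finsupp.single i 1) (taylorHom f) := by
  rw [← pderiv_taylorHom, coeff_pderiv, prod_factorial_add_single]
  push_cast
  ring

theorem factorial_mul_coeff_taylorHom_pd_pow {F : Type*} [Field F]
    (k : ℕ) (γ : Fin n →₀ ℕ) (i : Fin n) (f : MvPolynomial (Fin n) F) :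
    ((∏ j, (γ j).factorial : ℕ) : MvPolynomial (Fin n) F) *
        coeff γ (taylorHom ((pd i ^ k) f)) =
      ((∏ j, ((γ + Finsupp.single i k) j).factorial : ℕ) : MvPolynomial (Fin n) F) *
        coeff (γ + Finsupp.single i k) (taylorHom f) := by
  induction k generalizing γ with
  | zero => simp
  | succ k ih =>
    rw [pow_succ', Module.End.mul_apply]
    refine (factorial_mul_coeff_taylorHom_pderiv γ i _).trans ?_
    rw [ih, add_assoc, ← Finsupp.single_add, add_comm 1 k]

theorem factorial_mul_coeff_taylorHom_list_prod {F : Type*} [Field F]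
    (β : Fin n → ℕ) (l : List (Fin n))
    (γ : Fin n →₀ ℕ) (f : MvPolynomial (Fin n) F) :
    ((∏ j, (γ j).factorial : ℕ) : MvPolynomial (Fin n) F) *
        coeff γ (taylorHom ((l.map fun i => pd i ^ β i).prod f)) =
      ((∏ j, ((γ + (l.map fun i => Finsupp.single i (β i)).sum) j).factorial : ℕ) :
        MvPolynomial (Fin n) F) *
        coeff (γ + (l.map fun i => Finsupp.single i (β i)).sum) (taylorHom f) := by
  induction l generalizing γ with
  | nil => simp
  | cons i l ih =>
    rw [List.map_cons, List.prod_cons, Module.End.mul_apply,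
      factorial_mul_coeff_taylorHom_pd_pow, ih, List.map_cons, List.sum_cons, add_assoc]

theorem dpow_eq_factorial_mul_coeff_taylorHom {F : Type*} [Field F]
    (β : Fin n →₀ ℕ) (f : MvPolynomial (Fin n) F) :
    dpow β f =
      ((∏ j, (β j).factorial : ℕ) : MvPolynomial (Fin n) F) * coeff β (taylorHom f) := by
  have h := factorial_mul_coeff_taylorHom_list_prod β (List.finRange n) 0 f
  have hsum : ((List.finRange n).map fun i => Finsupp.single i (β i)).sum = β := by
    rw [← List.ofFn_eq_map, List.sum_ofFn, Finsupp.univ_sum_single]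
  rw [hsum, coeff_zero_taylorHom, zero_add, ← List.ofFn_eq_map] at h
  simpa [dpow] using h

theorem MvPolynomial.coeff_pow_eq_finsum {σ R : Type*} [CommSemiring R]
    (g : MvPolynomial σ R) (hg : coeff 0 g = 0) (d : σ →₀ ℕ) (k : ℕ) :
    coeff d (g ^ k) =
      ∑ᶠ (τ : Fin k → (σ →₀ ℕ)) (_ : (∀ l, τ l ≠ 0) ∧ ∑ l, τ l = d), ∏ l, coeff (τ l) g := by
  classical
  have hpow : coeff d (g ^ k) =
      ∑ τ ∈ Finset.finsuppAntidiag (Finset.univ : Finset (Fin k)) d, ∏ l, coeff (τ l) g := by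
    have h := MvPowerSeries.coeff_prod (fun _ : Fin k => (g : MvPowerSeries σ R)) d Finset.univ
    rw [Finset.prod_const, Finset.card_univ, Fintype.card_fin, ← MvPolynomial.coe_pow] at h
    simpa only [MvPolynomial.coeff_coe] using h
  have himage : coeff d (g ^ k) =
      ∑ τ ∈ (Finset.finsuppAntidiag (Finset.univ : Finset (Fin k)) d).map
        Finsupp.equivFunOnFinite.toEmbedding, ∏ l, coeff (τ l) g := by
    rw [hpow, Finset.sum_map]
    rfl
  rw [himage]
  refine (finsum_cond_eq_sum_of_cond_iff _ fun {τ} hτ => ?_).symm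
  have hne : ∀ l, τ l ≠ 0 := fun l hl =>
    hτ (Finset.prod_eq_zero (Finset.mem_univ l) (by rw [hl, hg]))
  rw [Finset.mem_map_equiv, Finset.mem_finsuppAntidiag]
  simp only [Finset.subset_univ, and_true]
  exact and_iff_right hne

theorem le_sum_of_sum_eq {k : ℕ} {σ : Fin k → (Fin n →₀ ℕ)} {β : Fin n →₀ ℕ}
    (hne : ∀ l, σ l ≠ 0) (hsum : ∑ l, σ l = β) : k ≤ ∑ i, β i := by
  have hpos : ∀ l, 1 ≤ ∑ i, σ l i := fun l => by
    rw [Nat.one_le_iff_ne_zero]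
    intro h
    exact hne l (Finsupp.ext fun i => Finset.sum_eq_zero_iff.mp h i (Finset.mem_univ i))
  calc k = ∑ _l : Fin k, 1 := by simp
    _ ≤ ∑ l, ∑ i, σ l i := Finset.sum_le_sum fun l _ => hpos l
    _ = ∑ i, β i := by
      rw [Finset.sum_comm, ← hsum]
      simp [Finsupp.finsetSum_apply]

theorem prod_factorial_dvd_of_sum_eq {k : ℕ} {σ : Fin k → (Fin n →₀ ℕ)} {β : Fin n →₀ ℕ}
    (hsum : ∑ l, σ l = β) :
    ∏ l, ∏ i, (σ l i).factorial ∣ ∏ i, (β i).factorial := by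
  rw [Finset.prod_comm, ← hsum]
  refine Finset.prod_dvd_prod_of_dvd _ _ fun i _ => ?_
  rw [Finsupp.finsetSum_apply]
  exact Nat.prod_factorial_dvd_factorial_sum _ _

theorem factorial_mul_coeff_taylorHom_sub_pow {F : Type*} [Field F]
    (f : MvPolynomial (Fin n) F) (β : Fin n →₀ ℕ) (k : ℕ) :
    ((∏ i, (β i).factorial : ℕ) : MvPolynomial (Fin n) F) * coeff β ((taylorHom f - C f) ^ k) =
      ∑ᶠ (σ : Fin k → (Fin n →₀ ℕ)) (_ : (∀ l, σ l ≠ 0) ∧ ∑ l, σ l = β),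
        (((∏ i, (β i).factorial) / ∏ l, ∏ i, (σ l i).factorial : ℕ) : MvPolynomial (Fin n) F) *
          ∏ l, dpow (σ l) f := by
  rw [coeff_pow_eq_finsum _ (by simp [coeff_zero_taylorHom])]
  refine (mul_finsum_mem (s := {σ : Fin k → (Fin n →₀ ℕ) | (∀ l, σ l ≠ 0) ∧ ∑ l, σ l = β})
    _ _).trans (finsum_mem_congr rfl fun σ ⟨hne, hsum⟩ => ?_)
  nth_rw 1 [← Nat.div_mul_cancel (prod_factorial_dvd_of_sum_eq hsum)]
  rw [Nat.cast_mul, mul_assoc, Nat.cast_prod, ← Finset.prod_mul_distrib]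
  congr 1
  refine Finset.prod_congr rfl fun l _ => ?_
  rw [dpow_eq_factorial_mul_coeff_taylorHom, coeff_sub, coeff_C, if_neg (hne l).symm, sub_zero]

/-- Lemma 8.2, the higher-derivative formula for powers, specialized at integer
exponents `m ≥ |β|` and written over ordered tuples: `∂^β(f^m)` equals
`Σ_{k=1}^{|β|} C(m,k) Σ_σ (β!/(σ_1!⋯σ_k!)) (∏_l ∂^{σ_l} f) · f^{m−k}`, the inner sum
ranging over all ordered `k`-tuples `σ` of nonzero multi-indices with
`σ_1 + … + σ_k = β`. -/
theorem dpow_pow_eq (hn : 0 < n) (f : MvPolynomial (Fin n) K)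
    (β : Fin n →₀ ℕ) (hβ : β ≠ 0) (m : ℕ) (hm : ∑ i : Fin n, β i ≤ m) :
    dpow β (f ^ m) =
      ∑ k ∈ Finset.Icc 1 (∑ i : Fin n, β i),
        (m.choose k : MvPolynomial (Fin n) K) *
          ∑ᶠ (σ : Fin k → (Fin n →₀ ℕ)) (_ : (∀ l, σ l ≠ 0) ∧ ∑ l : Fin k, σ l = β),
            ((((∏ i : Fin n, Nat.factorial (β i)) /
                ∏ l : Fin k, ∏ i : Fin n, Nat.factorial (σ l i) : ℕ) :
                MvPolynomial (Fin n) K) *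
              (∏ l : Fin k, dpow (σ l) f) * f ^ (m - k)) := by
  have hterm : ∀ k, ((∏ i, (β i).factorial : ℕ) : MvPolynomial (Fin n) K) *
      coeff β ((taylorHom f - C f) ^ k * C f ^ (m - k) *
        (m.choose k : MvPolynomial (Fin n) (MvPolynomial (Fin n) K))) =
      (m.choose k : MvPolynomial (Fin n) K) *
        ∑ᶠ (σ : Fin k → (Fin n →₀ ℕ)) (_ : (∀ l, σ l ≠ 0) ∧ ∑ l : Fin k, σ l = β),
          ((((∏ i : Fin n, Nat.factorial (β i)) /
              ∏ l : Fin k, ∏ i : Fin n, Nat.factorial (σ l i) : ℕ) :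
              MvPolynomial (Fin n) K) *
            (∏ l : Fin k, dpow (σ l) f) * f ^ (m - k)) := fun k => by
    refine Eq.trans ?_ (congrArg _ (finsum_mem_mul
      (s := {σ : Fin k → (Fin n →₀ ℕ) | (∀ l, σ l ≠ 0) ∧ ∑ l, σ l = β}) _ _))
    simp only [Set.mem_ofPred_eq]
    rw [← factorial_mul_coeff_taylorHom_sub_pow, mul_assoc,
      mul_comm (_ ^ k), ← C_pow, ← map_natCast (C : MvPolynomial (Fin n) K →+* _), ← C_mul,
      coeff_C_mul]
    ring
  rw [dpow_eq_factorial_mul_coeff_taylorHom, map_pow, ← sub_add_cancel (taylorHom f) (C f),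
    add_pow, coeff_sum, Finset.mul_sum, Finset.sum_congr rfl fun k _ => hterm k]
  symm
  refine Finset.sum_subset (fun k hk => ?_) fun k _ hk => ?_
  · rw [Finset.mem_Icc] at hk
    rw [Finset.mem_range]
    omega
  · refine mul_eq_zero_of_right _ (finsum_eq_zero_of_forall_eq_zero fun σ => ?_)
    have : IsEmpty ((∀ l, σ l ≠ 0) ∧ ∑ l, σ l = β) := ⟨fun ⟨hne, hsum⟩ => by
      have hle := le_sum_of_sum_eq hne hsum
      rcases Nat.eq_zero_or_pos k with rfl | hk0
      · exact hβ (by simpa using hsum.symm)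
      · exact hk (Finset.mem_Icc.mpr ⟨hk0, hle⟩)⟩
    exact finsum_of_isEmpty _
end
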